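/- Let E be a real inner product space. Then for all a, b ∈ E the following chain of inequalities holds: ‖a‖ ≤ √(1+‖a‖²) ≤ √2·√(1+‖a‖²+‖b‖²) ≤ √(1+‖a+b‖²) + √(1+‖a−b‖²) ≤ 2·√(1+‖a‖²+‖b‖²) ≤ 2·(1+‖a‖+‖b‖). -/

import Mathlib

theorem stmt_0 {E : Type*} [NormedAddCommGroup E] [InnerProductSpace ℝ E] (a b : E) :
    ‖a‖ ≤ Real.sqrt (1 + ‖a‖ ^ 2) ∧
    Real.sqrt (1 + ‖a‖ ^ 2) ≤ Real.sqrt 2 * Real.sqrt (1 + ‖a‖ ^ 2 + ‖b‖ ^ 2) ∧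
    Real.sqrt 2 * Real.sqrt (1 + ‖a‖ ^ 2 + ‖b‖ ^ 2) ≤
      Real.sqrt (1 + ‖a + b‖ ^ 2) + Real.sqrt (1 + ‖a - b‖ ^ 2) ∧
    Real.sqrt (1 + ‖a + b‖ ^ 2) + Real.sqrt (1 + ‖a - b‖ ^ 2) ≤
      2 * Real.sqrt (1 + ‖a‖ ^ 2 + ‖b‖ ^ 2) ∧
    2 * Real.sqrt (1 + ‖a‖ ^ 2 + ‖b‖ ^ 2) ≤ 2 * (1 + ‖a‖ + ‖b‖) := by
  have ha := norm_nonneg a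
  have hb := norm_nonneg b
  have hpar : ‖a + b‖ ^ 2 + ‖a - b‖ ^ 2 = 2 * (‖a‖ ^ 2 + ‖b‖ ^ 2) := by
    have h := parallelogram_law_with_norm ℝ a b
    linarith
  have hu := Real.sq_sqrt (show 0 ≤ 1 + ‖a + b‖ ^ 2 by positivity)
  have hv := Real.sq_sqrt (show 0 ≤ 1 + ‖a - b‖ ^ 2 by positivity)
  have hS := Real.sq_sqrt (show 0 ≤ 1 + ‖a‖ ^ 2 + ‖b‖ ^ 2 by positivity)
  have hu0 := Real.sqrt_nonneg (1 + ‖a + b‖ ^ 2)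
  have hv0 := Real.sqrt_nonneg (1 + ‖a - b‖ ^ 2)
  refine ⟨Real.le_sqrt_of_sq_le (by linarith), ?_, ?_, ?_, ?_⟩
  · rw [← Real.sqrt_mul (by norm_num)]
    exact Real.sqrt_le_sqrt (by nlinarith [sq_nonneg ‖a‖, sq_nonneg ‖b‖])
  · rw [← Real.sqrt_mul (by norm_num)]
    exact Real.sqrt_le_iff.mpr ⟨by positivity, by nlinarith [mul_nonneg hu0 hv0]⟩
  · refine abs_le_of_sq_le_sq' ?_ (by positivity) |>.2
    nlinarith [sq_nonneg (Real.sqrt (1 + ‖a + b‖ ^ 2) - Real.sqrt (1 + ‖a - b‖ ^ 2))]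
  · gcongr
    exact Real.sqrt_le_iff.mpr ⟨by positivity, by nlinarith [mul_nonneg ha hb]⟩
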